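/- arXiv:1508.06188 — 2 statements merged into one kernel-verified Lean document; each statement's English description precedes it below -/
import Mathlib

section
/- Let k ≥ 2 and A ∈ M_k(ℂ) with det A = 1. Suppose that for all 1 ≤ s, t ≤ k the entry a_{st} of A equals the minor of A obtained by deleting row ι(s) = k+1-s and column ι(t) = k+1-t (i.e., a_{st} = A_{{ι(s)}̄, {ι(t)}̄}). Then Aᵀ J_k A = J_k; in particular, A is symplectic if k is even and special orthogonal if k is odd. -/
open Matrix

/-- The antidiagonal matrix `J_k` with `(J_k)_{i, k+1-i} = (-1)^(i-1)` (1-indexed). -/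
noncomputable def Jmat (k : ℕ) : Matrix (Fin k) (Fin k) ℂ :=
  Matrix.of fun i j => if (i : ℕ) + (j : ℕ) + 1 = k then (-1 : ℂ) ^ (i : ℕ) else 0

/-- The minor `A_{S,T}` of `A` with rows `S` and columns `T` in increasing order
(`0` if the cardinalities differ). -/
noncomputable def gminor {k : ℕ} (A : Matrix (Fin k) (Fin k) ℂ)
    (S T : Finset (Fin k)) : ℂ :=
  if h : T.card = S.card then
    Matrix.det (Matrix.of fun i j : Fin S.card =>
      A (S.orderIsoOfFin rfl i) (T.orderIsoOfFin h j))
  else 0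

theorem gminor_eq_det_orderEmbOfFin {k m : ℕ} (A : Matrix (Fin k) (Fin k) ℂ)
    {S T : Finset (Fin k)} (hS : S.card = m) (hT : T.card = m) :
    gminor A S T =
      (A.submatrix (S.orderEmbOfFin hS) (T.orderEmbOfFin hT)).det := by
  subst hS
  rw [gminor, dif_pos hT]
  rfl

theorem gminor_compl_singleton {n : ℕ} (A : Matrix (Fin (n + 1)) (Fin (n + 1)) ℂ)
    (a b : Fin (n + 1)) :
    gminor A {a}ᶜ {b}ᶜ = (A.submatrix a.succAbove b.succAbove).det := by
  have hc (c : Fin (n + 1)) : ({c}ᶜ : Finset (Fin (n + 1))).card = n := by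
    simp [Finset.card_compl]
  have he (c : Fin (n + 1)) : ⇑(({c}ᶜ : Finset (Fin (n + 1))).orderEmbOfFin (hc c)) =
      c.succAbove :=
    (Finset.orderEmbOfFin_unique (hc c) (fun x => by simp)
      c.strictMono_succAbove).symm
  rw [gminor_eq_det_orderEmbOfFin A (hc a) (hc b), he, he]

theorem Jmat_apply {k : ℕ} (i j : Fin k) :
    Jmat k i j = if j = i.rev then (-1 : ℂ) ^ (i : ℕ) else 0 := by
  simp only [Jmat, of_apply]
  congr 1
  simp only [Fin.ext_iff, Fin.val_rev, eq_iff_iff]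
  omega

theorem Jmat_mul_apply {k : ℕ} (A : Matrix (Fin k) (Fin k) ℂ) (i j : Fin k) :
    (Jmat k * A) i j = (-1 : ℂ) ^ (i : ℕ) * A i.rev j := by
  simp [mul_apply, Jmat_apply]

/-- if `A` has determinant `1` and every entry `a_{st}` equals the minor
of `A` obtained by deleting row `ι(s)` and column `ι(t)` (where `ι(j) = k+1-j` is the
index inversion, here `Fin.rev`), then `Aᵀ J_k A = J_k`; in particular `A` is
symplectic when `k` is even and special orthogonal when `k` is odd. -/
theorem minor_identity_implies_symplectic_or_orthogonal
    (k : ℕ) (hk : 2 ≤ k) (A : Matrix (Fin k) (Fin k) ℂ)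
    (hdet : A.det = 1)
    (h : ∀ s t : Fin k, A s t = gminor A ({Fin.rev s}ᶜ) ({Fin.rev t}ᶜ)) :
    Aᵀ * Jmat k * A = Jmat k := by
  obtain ⟨n, rfl⟩ : ∃ n, k = n + 1 := ⟨k - 1, by omega⟩
  have hJA (l j : Fin (n + 1)) :
      (Jmat (n + 1) * A) l j = (-1 : ℂ) ^ (j.rev : ℕ) * A.adjugate j.rev l := by
    rw [Jmat_mul_apply, h, gminor_compl_singleton, Fin.rev_rev,
      adjugate_fin_succ_eq_det_submatrix, pow_add]
    have hs : (-1 : ℂ) ^ (j.rev : ℕ) * (-1 : ℂ) ^ (j.rev : ℕ) = 1 := by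
      rw [← mul_pow]; simp
    linear_combination (-(-1 : ℂ) ^ (l : ℕ) *
      (A.submatrix l.succAbove j.rev.succAbove).det) * hs
  ext i j
  have hadj : ∑ l, A.adjugate j.rev l * A l i = if j.rev = i then 1 else 0 := by
    rw [← mul_apply, adjugate_mul, hdet, one_smul, one_apply]
  rw [Matrix.mul_assoc, mul_apply]
  calc ∑ l, Aᵀ i l * (Jmat (n + 1) * A) l j
      = (-1 : ℂ) ^ (j.rev : ℕ) * ∑ l, A.adjugate j.rev l * A l i := by
        rw [Finset.mul_sum]
        refine Finset.sum_congr rfl fun l _ => ?_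
        rw [hJA, transpose_apply]
        ring
    _ = Jmat (n + 1) i j := by
        rw [hadj, Jmat_apply]
        by_cases hij : j.rev = i
        · subst hij
          simp
        · have hji : j ≠ i.rev := fun e => hij (by simp [e])
          simp [hij, hji]
end

section
/- Let k ≥ 1 and W ∈ M_k(ℂ). Suppose there exists a unipotent upper-triangular matrix U ∈ M_k(ℂ) such that A = WU satisfies Aᵀ J_k A = J_k and det A = 1. Then for every 1 ≤ m ≤ k and every subset S ⊆ {1,…,k} of cardinality m, the minors of W satisfy W_{S, {1,…,m}} = W_{ι(S̄), {1,…,k-m}}. -/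
open Matrix

/-- The set of the first `m` column (or row) indices `{1,…,m}` inside `{1,…,k}`. -/
def colSet (k m : ℕ) : Finset (Fin k) := Finset.univ.filter fun j => (j : ℕ) < m

/-- Jacobi's complementary minor formula for block matrices. -/
theorem Matrix.det_toBlocks₁₁_of_transpose_mul_eq_one {p q R : Type*} [Fintype p] [Fintype q]
    [DecidableEq p] [DecidableEq q] [CommRing R] {M N : Matrix (p ⊕ q) (p ⊕ q) R}
    (h : Mᵀ * N = 1) : M.toBlocks₁₁.det = M.det * N.toBlocks₂₂.det := by
  have h' : M * Nᵀ = 1 := by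
    rw [mul_eq_one_comm, ← transpose_transpose M, ← transpose_mul, h, transpose_one]
  have key : M * fromBlocks 1 N.toBlocks₂₁ᵀ 0 N.toBlocks₂₂ᵀ =
      fromBlocks M.toBlocks₁₁ 0 M.toBlocks₂₁ 1 := by
    rw [← fromBlocks_toBlocks M, ← fromBlocks_toBlocks N, fromBlocks_transpose,
      fromBlocks_multiply, ← fromBlocks_one, fromBlocks_inj] at h'
    conv_lhs => rw [← fromBlocks_toBlocks M]
    rw [fromBlocks_multiply]
    simp [h'.2.1, h'.2.2.2]
  have := congrArg det key
  rw [det_mul, det_fromBlocks_zero₂₁, det_fromBlocks_zero₁₂] at this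
  simpa using this.symm

/-- If `i` is a left-to-right maximum of `σ`, then the inversions starting at `i` number
`σ i - i`. -/
theorem prod_Ioi_sign_of_forall_lt {n : ℕ} (σ : Equiv.Perm (Fin n)) {i : Fin n}
    (h : ∀ j < i, σ j < σ i) :
    (∏ j ∈ Finset.Ioi i, if σ i < σ j then (1 : ℤ) else -1) =
      (-1) ^ (σ i : ℕ) * (-1) ^ (i : ℕ) := by
  have hcard : (Finset.univ.filter fun j => σ j < σ i).card = σ i := by
    rw [← Fin.card_Iio (σ i), ← Finset.card_map σ.toEmbedding]
    congr 1
    ext x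
    simp
  have hsplit : (Finset.univ.filter fun j => σ j < σ i) =
      Finset.Iio i ∪ (Finset.Ioi i).filter fun j => ¬ σ i < σ j := by
    ext j
    simp only [Finset.mem_filter, Finset.mem_univ, true_and, Finset.mem_union, Finset.mem_Iio,
      Finset.mem_Ioi, not_lt]
    rcases lt_trichotomy j i with hj | rfl | hj
    · simp [hj, h j hj]
    · simp
    · simp only [hj, hj.not_gt, true_and, false_or]
      exact ⟨le_of_lt, fun h' => lt_of_le_of_ne h' fun e => hj.ne' (σ.injective e)⟩
  rw [hsplit, Finset.card_union_of_disjoint, Fin.card_Iio] at hcard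
  · rw [Finset.prod_ite, Finset.prod_const_one, one_mul, Finset.prod_const, ← hcard, pow_add,
      mul_right_comm, ← mul_pow]
    simp
  · rw [Finset.disjoint_left]
    intro j hj hj'
    simp only [Finset.mem_Iio, Finset.mem_filter, Finset.mem_Ioi] at hj hj'
    exact hj.not_gt hj'.1

/-- The sign of a shuffle: a permutation increasing on the first `m` and on the last `n` indices. -/
theorem sign_of_strictMono_blocks {m n : ℕ} (σ : Equiv.Perm (Fin (m + n)))
    (h₁ : StrictMono fun i : Fin m => σ (Fin.castAdd n i))
    (h₂ : StrictMono fun i : Fin n => σ (Fin.natAdd m i)) :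
    (Equiv.Perm.sign σ : ℤ) =
      ∏ i : Fin m, (-1) ^ (σ (Fin.castAdd n i) : ℕ) * (-1) ^ (i : ℕ) := by
  rw [Equiv.Perm.sign_eq_prod_prod_Ioi]
  simp only [Units.coe_prod, apply_ite Units.val, Units.val_one, Units.val_neg]
  rw [Fin.prod_univ_add, Finset.prod_congr rfl fun i _ => prod_Ioi_sign_of_forall_lt σ ?_,
    Finset.prod_eq_one fun i _ => Finset.prod_eq_one fun j hj => if_pos ?_]
  · simp
  · rw [Finset.mem_Ioi] at hj
    induction j using Fin.addCases with
    | left j => simp only [Fin.lt_def, Fin.val_natAdd, Fin.val_castAdd] at hj; omega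
    | right j => exact h₂ ((Fin.natAdd_lt_natAdd_iff m).1 hj)
  · intro j hj
    induction j using Fin.addCases with
    | left j => exact h₁ hj
    | right j => simp only [Fin.lt_def, Fin.val_natAdd, Fin.val_castAdd] at hj; omega

/-- A minor may be computed along any increasing enumerations of its rows and columns. -/
theorem gminor_eq_det_submatrix {k n : ℕ} (A : Matrix (Fin k) (Fin k) ℂ) {S T : Finset (Fin k)}
    {f g : Fin n → Fin k} (hf : StrictMono f) (hg : StrictMono g)
    (hS : Finset.univ.image f = S) (hT : Finset.univ.image g = T) :
    gminor A S T = (A.submatrix f g).det := by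
  have hSn : S.card = n := by rw [← hS, Finset.card_image_of_injective _ hf.injective]; simp
  have hTn : T.card = n := by rw [← hT, Finset.card_image_of_injective _ hg.injective]; simp
  subst hSn
  rw [gminor, dif_pos hTn]
  congr 1
  have hf' := Finset.orderEmbOfFin_unique (s := S) rfl (f := f) (by simp [← hS]) hf
  have hg' := Finset.orderEmbOfFin_unique (s := T) hTn (f := g) (by simp [← hT]) hg
  rw [hf', hg']
  rfl

theorem Jmat_submatrix_rev (k : ℕ) :
    (Jmat k).submatrix id Fin.rev = diagonal fun i : Fin k => (-1 : ℂ) ^ (i : ℕ) := by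
  ext i j
  have : (i : ℕ) + (k - (j + 1)) + 1 = k ↔ i = j := by rw [Fin.ext_iff]; omega
  simp [Jmat, diagonal_apply, this]

theorem transpose_signed_mul_submatrix_rev {k : ℕ} {A : Matrix (Fin k) (Fin k) ℂ}
    (h : Aᵀ * Jmat k * A = Jmat k) :
    (diagonal (fun i : Fin k => (-1 : ℂ) ^ (i : ℕ)) * A *
      diagonal fun i : Fin k => (-1 : ℂ) ^ (i : ℕ))ᵀ * A.submatrix Fin.rev Fin.rev = 1 := by
  have hJ := Jmat_submatrix_rev k
  set D := diagonal fun i : Fin k => (-1 : ℂ) ^ (i : ℕ) with hD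
  have hDD : D * D = 1 := by simp [hD, ← mul_pow]
  have h1 : (Aᵀ * Jmat k).submatrix id Fin.revPerm * A.submatrix Fin.revPerm Fin.rev = D := by
    rw [submatrix_mul_equiv, h, hJ]
  have h2 : (Aᵀ * Jmat k).submatrix id Fin.revPerm = Aᵀ * D := by
    rw [← hJ, submatrix_mul _ _ id id _ Function.bijective_id]; rfl
  rw [h2] at h1
  rw [transpose_mul, transpose_mul, show Dᵀ = D from diagonal_transpose _, Matrix.mul_assoc D,
    ← hDD]
  exact congrArg (D * ·) h1

/-- Minors on initial columns are unchanged by a unipotent upper-triangular column operation. -/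
theorem det_submatrix_castLE_mul {k m : ℕ} (hm : m ≤ k) {W U : Matrix (Fin k) (Fin k) ℂ}
    (hUtri : ∀ i j : Fin k, j < i → U i j = 0) (hUdiag : ∀ i : Fin k, U i i = 1)
    (f : Fin m → Fin k) :
    ((W * U).submatrix f (Fin.castLE hm)).det = (W.submatrix f (Fin.castLE hm)).det := by
  obtain ⟨n, rfl⟩ := Nat.exists_eq_add_of_le hm
  have hmul : (W * U).submatrix f (Fin.castLE hm) =
      W.submatrix f (Fin.castLE hm) * U.submatrix (Fin.castLE hm) (Fin.castLE hm) := by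
    ext i j
    simp only [submatrix_apply, mul_apply, Fin.sum_univ_add]
    rw [add_eq_left.2 (Finset.sum_eq_zero fun x _ => ?_)]
    · rfl
    · rw [hUtri _ _ (by simp only [Fin.lt_def, Fin.val_natAdd, Fin.val_castLE]; omega), mul_zero]
  have hdet : (U.submatrix (Fin.castLE hm) (Fin.castLE hm)).det = 1 := by
    have hU : (U.submatrix (Fin.castLE hm) (Fin.castLE hm)).IsUpperTriangular :=
      fun i j hij => hUtri _ _ hij
    rw [det_of_isUpperTriangular hU]
    simp [hUdiag]
  rw [hmul, det_mul, hdet, mul_one]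

/-- Complementary minors of a matrix preserving the form `Jmat` coincide. -/
theorem det_submatrix_eq_of_preserves_Jmat {m n : ℕ}
    {A : Matrix (Fin (m + n)) (Fin (m + n)) ℂ}
    (h : Aᵀ * Jmat (m + n) * A = Jmat (m + n)) (hdet : A.det = 1)
    {S : Finset (Fin (m + n))} (hm : S.card = m) (hn : Sᶜ.card = n) :
    (A.submatrix (S.orderEmbOfFin hm) (Fin.castAdd n)).det =
      (A.submatrix (Fin.rev ∘ Sᶜ.orderEmbOfFin hn) (Fin.rev ∘ Fin.natAdd m)).det := by
  set r := finSumEquivOfFinset hm hn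
  set c := finSumFinEquiv (m := m) (n := n)
  set d : Fin (m + n) → ℂ := fun i => (-1) ^ (i : ℕ) with hd
  set B := diagonal d * A * diagonal d with hB
  have hdd : (diagonal d).det * (diagonal d).det = 1 := by
    rw [← det_mul, diagonal_mul_diagonal]
    simp [hd, ← mul_pow]
  have hBdet : B.det = 1 := by rw [hB, det_mul, det_mul, hdet, mul_one, hdd]
  have hinv : (B.submatrix r c)ᵀ * (A.submatrix Fin.rev Fin.rev).submatrix r c = 1 := by
    rw [transpose_submatrix, submatrix_mul_equiv, transpose_signed_mul_submatrix_rev h,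
      submatrix_one_equiv]
  have hJac := det_toBlocks₁₁_of_transpose_mul_eq_one hinv
  have hsign := sign_of_strictMono_blocks (c.symm.trans r)
    (fun i j hij => by simpa [c, r] using hij) (fun i j hij => by simpa [c, r] using hij)
  have hsign' : (Equiv.Perm.sign (c.symm.trans r) : ℂ) =
      (∏ i, d (S.orderEmbOfFin hm i)) * ∏ i, d (Fin.castAdd n i) := by
    rw [hsign, ← Finset.prod_mul_distrib]
    push_cast
    simp [c, r, hd]
  have hM : (B.submatrix r c).det =
      (∏ i, d (S.orderEmbOfFin hm i)) * ∏ i, d (Fin.castAdd n i) := by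
    rw [← hsign', ← mul_one (Equiv.Perm.sign (c.symm.trans r) : ℂ), ← hBdet, ← det_permute,
      ← det_submatrix_equiv_self c (B.submatrix _ _)]
    congr 1
    ext i j
    simp
  have h11 : (B.submatrix r c).toBlocks₁₁.det =
      (∏ i, d (S.orderEmbOfFin hm i)) * (∏ i, d (Fin.castAdd n i)) *
        (A.submatrix (S.orderEmbOfFin hm) (Fin.castAdd n)).det := by
    rw [mul_right_comm, ← det_diagonal, ← det_diagonal, ← det_mul, ← det_mul]
    congr 1
    ext i j
    simp [toBlocks₁₁, hB, r, c]
  rw [h11, hM] at hJac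
  refine mul_left_cancel₀ (mul_ne_zero ?_ ?_) hJac <;>
    exact Finset.prod_ne_zero_iff.2 fun i _ => pow_ne_zero _ (by norm_num)

/-- if `W` becomes symplectic/orthogonal (with `det = 1`) after
right-multiplication by some unipotent upper-triangular `U`, then for every
`1 ≤ m ≤ k` and every row set `S` of cardinality `m`,
`W_{S, {1,…,m}} = W_{ι(S̄), {1,…,k-m}}`. -/
theorem wronskian_minor_identity (k : ℕ) (hk : 1 ≤ k)
    (W U : Matrix (Fin k) (Fin k) ℂ)
    (hUtri : ∀ i j : Fin k, j < i → U i j = 0) (hUdiag : ∀ i : Fin k, U i i = 1)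
    (hsymp : (W * U)ᵀ * Jmat k * (W * U) = Jmat k) (hdet : (W * U).det = 1) :
    ∀ m : ℕ, 1 ≤ m → m ≤ k → ∀ S : Finset (Fin k), S.card = m →
      gminor W S (colSet k m) = gminor W (Sᶜ.image Fin.rev) (colSet k (k - m)) := by
  rintro m - hmk S hS
  obtain ⟨n, rfl⟩ := Nat.exists_eq_add_of_le hmk
  have hSc : Sᶜ.card = n := by rw [Finset.card_compl, hS, Fintype.card_fin]; omega
  have hcol : ∀ l (hl : l ≤ m + n), Finset.univ.image (Fin.castLE hl) = colSet (m + n) l := by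
    intro l hl
    ext j
    simp only [colSet, Finset.mem_image, Finset.mem_univ, true_and, Finset.mem_filter]
    exact ⟨by rintro ⟨i, rfl⟩; exact i.2, fun hj => ⟨⟨j, hj⟩, rfl⟩⟩
  have hrev : StrictMono (Fin.rev ∘ Sᶜ.orderEmbOfFin hSc ∘ Fin.rev) := fun i j hij => by
    simpa using hij
  rw [Nat.add_sub_cancel_left,
    gminor_eq_det_submatrix W (S.orderEmbOfFin hS).strictMono (Fin.strictMono_castLE hmk)
      (by simp) (hcol _ _),
    gminor_eq_det_submatrix W hrev (Fin.strictMono_castLE (Nat.le_add_left n m))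
      (by rw [← Finset.image_image, ← Finset.image_image, Finset.image_univ_of_surjective
        Fin.rev_surjective]; simp) (hcol _ _),
    ← det_submatrix_castLE_mul _ hUtri hUdiag (S.orderEmbOfFin hS),
    ← det_submatrix_castLE_mul _ hUtri hUdiag (Fin.rev ∘ _)]
  refine (det_submatrix_eq_of_preserves_Jmat hsymp hdet hS hSc).trans ?_
  rw [← det_submatrix_equiv_self Fin.revPerm, submatrix_submatrix]
  congr 2
  ext i
  simp
  omega
end
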